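/- Let p be an odd prime and let G be a quasi-powerful p-group. Then for any g, h ∈ G there exist j ∈ G and z ∈ Z(G) such that g^p · h^p = j^p · z. -/

import Mathlib

/-- The subgroup of `G` generated by all `n`-th powers. -/
def powSubgroup (G : Type*) [Group G] (n : ℕ) : Subgroup G :=
  Subgroup.closure {x : G | ∃ g : G, g ^ n = x}

/-- `Ω_k`-type subgroup: generated by all elements whose `n`-th power is trivial. -/
def omegaSubgroup (G : Type*) [Group G] (n : ℕ) : Subgroup G :=
  Subgroup.closure {g : G | g ^ n = 1}

/-- A group is powerful (for a prime `p`) if `[G,G] ≤ G^p`. -/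
def IsPowerful (p : ℕ) (G : Type*) [Group G] : Prop :=
  commutator G ≤ powSubgroup G p

/-- A group is quasi-powerful (for a prime `p`) if `G/Z(G)` is powerful. -/
def IsQuasiPowerful (p : ℕ) (G : Type*) [Group G] : Prop :=
  IsPowerful p (G ⧸ Subgroup.center G)

/-- The commutator `[x,y] = x⁻¹y⁻¹xy`. -/
def pcomm {G : Type*} [Group G] (a b : G) : G := a⁻¹ * b⁻¹ * a * b

open scoped commutatorElement

theorem mul_pow_of_mul_comm_mul {G : Type*} [Group G] {x c d : G} (hc : c * x = x * c * d)
    (hdx : Commute d x) (hdc : Commute d c) (n : ℕ) :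
    (x * c) ^ n = x ^ n * c ^ n * d ^ n.choose 2 := by
  have hcx (n : ℕ) : c ^ n * x = x * c ^ n * d ^ n := by
    induction n with
    | zero => simp
    | succ n ih =>
      calc c ^ (n + 1) * x = c ^ n * x * c * d := by rw [pow_succ, mul_assoc, hc]; group
        _ = x * c ^ n * (d ^ n * c) * d := by rw [ih]; group
        _ = x * c ^ (n + 1) * d ^ (n + 1) := by rw [(hdc.pow_left n).eq]; group
  induction n with
  | zero => simp
  | succ n ih =>
    have hd : Commute (d ^ n.choose 2) (x * c) := (hdx.mul_right hdc).pow_left _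
    calc (x * c) ^ (n + 1) = x ^ n * c ^ n * (d ^ n.choose 2 * (x * c)) := by
          rw [pow_succ, ih]; group
      _ = x ^ n * (c ^ n * x) * c * d ^ n.choose 2 := by rw [hd.eq]; group
      _ = x ^ n * x * c ^ n * (d ^ n * c) * d ^ n.choose 2 := by rw [hcx]; group
      _ = x ^ (n + 1) * c ^ (n + 1) * (d ^ n * d ^ n.choose 2) := by
          rw [(hdc.pow_left n).eq, pow_succ, pow_succ]; simp only [mul_assoc]
      _ = x ^ (n + 1) * c ^ (n + 1) * d ^ (n + 1).choose 2 := by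
          rw [← pow_add, Nat.choose_succ_succ' n 1, Nat.choose_one_right]

theorem mul_pow_of_mul_comm_mul_of_pow_eq_one {G : Type*} [Group G] {p : ℕ} (hodd : Odd p)
    {x c d : G} (hc : c * x = x * c * d) (hdx : Commute d x) (hdc : Commute d c)
    (hd : d ^ p = 1) : (x * c) ^ p = x ^ p * c ^ p := by
  have hdvd : p ∣ p.choose 2 := by
    obtain ⟨k, rfl⟩ := hodd
    refine ⟨k, ?_⟩
    rw [Nat.choose_two_right, Nat.add_sub_cancel, mul_left_comm, Nat.mul_div_cancel_left _ two_pos]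
  obtain ⟨k, hk⟩ := hdvd
  rw [mul_pow_of_mul_comm_mul hc hdx hdc, hk, pow_mul, hd, one_pow, mul_one]

theorem pow_mem_powSubgroup {G : Type*} [Group G] (n : ℕ) (g : G) : g ^ n ∈ powSubgroup G n :=
  Subgroup.subset_closure ⟨g, rfl⟩

theorem map_powSubgroup_le {G H : Type*} [Group G] [Group H] (f : G →* H) (n : ℕ) :
    (powSubgroup G n).map f ≤ powSubgroup H n := by
  rw [Subgroup.map_le_iff_le_comap, powSubgroup, Subgroup.closure_le]
  rintro _ ⟨g, rfl⟩
  simpa using pow_mem_powSubgroup n (f g)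

theorem map_powSubgroup_of_surjective {G H : Type*} [Group G] [Group H] {f : G →* H}
    (hf : Function.Surjective f) (n : ℕ) : (powSubgroup G n).map f = powSubgroup H n := by
  refine le_antisymm (map_powSubgroup_le f n) ?_
  rw [powSubgroup, Subgroup.closure_le]
  rintro _ ⟨h, rfl⟩
  obtain ⟨g, rfl⟩ := hf h
  exact ⟨g ^ n, pow_mem_powSubgroup n g, map_pow f g n⟩

instance powSubgroup_characteristic (G : Type*) [Group G] (n : ℕ) :
    (powSubgroup G n).Characteristic :=
  Subgroup.characteristic_iff_map_le.mpr fun f => map_powSubgroup_le f.toMonoidHom n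

theorem IsPowerful.of_surjective {p : ℕ} {G H : Type*} [Group G] [Group H] (hG : IsPowerful p G)
    {f : G →* H} (hf : Function.Surjective f) : IsPowerful p H := by
  rw [IsPowerful, ← map_powSubgroup_of_surjective hf, commutator_def,
    ← Subgroup.map_top_of_surjective f hf, ← Subgroup.map_commutator]
  exact Subgroup.map_mono hG

theorem pow_eq_one_of_mem_powSubgroup_of_surjective {n : ℕ} {G H : Type*} [Group G] [Group H]
    {f : G →* H} (hf : Function.Surjective f) (h : ∀ m ∈ powSubgroup G n, f m ^ n = 1) :
    ∀ m ∈ powSubgroup H n, m ^ n = 1 := by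
  rw [← map_powSubgroup_of_surjective hf]
  rintro _ ⟨m, hm, rfl⟩
  exact h m hm

theorem IsPowerful.commutatorElement_mem {p : ℕ} {G : Type*} [Group G] (hG : IsPowerful p G)
    (x y : G) : ⁅x, y⁆ ∈ powSubgroup G p :=
  hG (Subgroup.commutator_mem_commutator (Subgroup.mem_top x) (Subgroup.mem_top y))

/-- In a nilpotent powerful group, if the subgroup of `p`-th powers has exponent `p`, then it is
central. -/
theorem IsPowerful.powSubgroup_le_center {p : ℕ} (hodd : Odd p) (G : Type*) [Group G]
    [Group.IsNilpotent G] (hG : IsPowerful p G) (hexp : ∀ m ∈ powSubgroup G p, m ^ p = 1) :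
    powSubgroup G p ≤ Subgroup.center G := by
  revert hG hexp
  refine Group.nilpotent_center_quotient_ind (P := fun G _ _ => IsPowerful p G →
    (∀ m ∈ powSubgroup G p, m ^ p = 1) → powSubgroup G p ≤ Subgroup.center G) G ?_ ?_
  · intro G _ _ _ _ x _
    exact Subgroup.mem_center_iff.mpr fun y => Subsingleton.elim _ _
  · intro G _ _ ih hG hexp
    have hsurj := QuotientGroup.mk'_surjective (Subgroup.center G)
    have hq := ih (hG.of_surjective hsurj)
      (pow_eq_one_of_mem_powSubgroup_of_surjective hsurj fun m hm => by
        rw [← map_pow, hexp m hm, map_one])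
    rw [powSubgroup, Subgroup.closure_le]
    rintro _ ⟨x, rfl⟩
    refine Subgroup.mem_center_iff.mpr fun g => ?_
    set c : G := ⁅x⁻¹, g⁻¹⁆ with hc
    have hcM : c ∈ powSubgroup G p := hG.commutatorElement_mem _ _
    have hd : ⁅c⁻¹, x⁻¹⁆ ∈ Subgroup.center G := by
      rw [← QuotientGroup.ker_mk' (Subgroup.center G), MonoidHom.mem_ker, map_commutatorElement,
        commutatorElement_eq_one_iff_mul_comm]
      refine (Subgroup.mem_center_iff.mp (hq ?_) _).symm
      exact map_powSubgroup_le _ _ ⟨c⁻¹, inv_mem hcM, rfl⟩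
    have hpow : (x * c) ^ p = x ^ p * c ^ p :=
      mul_pow_of_mul_comm_mul_of_pow_eq_one hodd (d := ⁅c⁻¹, x⁻¹⁆)
        (by rw [commutatorElement_def]; group)
        (Subgroup.mem_center_iff.mp hd x).symm (Subgroup.mem_center_iff.mp hd c).symm
        (hexp _ (hG.commutatorElement_mem _ _))
    have hxc : x * c = g⁻¹ * x * g⁻¹⁻¹ := by rw [hc, commutatorElement_def]; group
    rw [hxc, conj_pow, hexp c hcM, mul_one, inv_inv] at hpow
    nth_rewrite 1 [← hpow]
    group

/-- If the subgroup of `p`-th powers is central, contains the commutators and has exponent `p`,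
then `p`-th powers are closed under products. -/
theorem IsPowerful.exists_pow_eq_of_le_center {p : ℕ} (hodd : Odd p) {G : Type*} [Group G]
    (hG : IsPowerful p G) (hcen : powSubgroup G p ≤ Subgroup.center G)
    (hexp : ∀ m ∈ powSubgroup G p, m ^ p = 1) {m : G} (hm : m ∈ powSubgroup G p) :
    ∃ x : G, x ^ p = m := by
  induction hm using Subgroup.closure_induction with
  | mem x hx => exact hx
  | one => exact ⟨1, one_pow p⟩
  | inv a _ ha =>
    obtain ⟨x, rfl⟩ := ha
    exact ⟨x⁻¹, inv_pow x p⟩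
  | mul a b _ _ ha hb =>
    obtain ⟨x, rfl⟩ := ha
    obtain ⟨y, rfl⟩ := hb
    have hd := hG.commutatorElement_mem y⁻¹ x⁻¹
    exact ⟨x * y, mul_pow_of_mul_comm_mul_of_pow_eq_one hodd (d := ⁅y⁻¹, x⁻¹⁆)
      (by rw [commutatorElement_def]; group)
      (Subgroup.mem_center_iff.mp (hcen hd) x).symm (Subgroup.mem_center_iff.mp (hcen hd) y).symm
      (hexp _ hd)⟩

theorem IsPGroup.powSubgroup_le_frattini {p : ℕ} (hp : p.Prime) {G : Type*} [Group G] [Finite G]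
    (hG : IsPGroup p G) : powSubgroup G p ≤ frattini G := by
  have : Fact p.Prime := ⟨hp⟩
  have := hG.isNilpotent
  rw [frattini, Order.radical, le_iInf₂_iff]
  intro N hN
  have : N.Normal := Subgroup.NormalizerCondition.normal_of_coatom N
    Group.normalizerCondition_of_isNilpotent hN
  rw [powSubgroup, Subgroup.closure_le]
  rintro _ ⟨g, rfl⟩
  by_contra hg
  have htop : N ⊔ Subgroup.zpowers (g ^ p) = ⊤ := by
    refine hN.2 _ (lt_of_le_of_ne le_sup_left fun h => hg ?_)
    rw [h]
    exact Subgroup.mem_sup_right (Subgroup.mem_zpowers _)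
  obtain ⟨n, hn, z, hz, hnz⟩ := Subgroup.mem_sup_of_normal_left.mp
    (htop ▸ Subgroup.mem_top g : g ∈ N ⊔ Subgroup.zpowers (g ^ p))
  obtain ⟨k, rfl⟩ := Subgroup.mem_zpowers_iff.mp hz
  obtain ⟨m, hm⟩ := hG g
  have h1 : g ^ (1 - p * k : ℤ) ∈ N := by
    have : g ^ (1 - p * k : ℤ) = n := by
      rw [zpow_sub, zpow_one, zpow_mul, zpow_natCast, mul_inv_eq_iff_eq_mul, hnz]
    rwa [this]
  have hcop : IsCoprime (1 - p * k : ℤ) ((p : ℤ) ^ m) :=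
    IsCoprime.pow_right ⟨1, k, by ring⟩
  obtain ⟨a, b, hab⟩ := hcop
  have hgN : g ∈ N := by
    rw [← zpow_one g, ← hab, zpow_add, mul_comm a, zpow_mul, mul_comm b, zpow_mul g]
    have hm' : g ^ ((p : ℤ) ^ m) = 1 := by exact_mod_cast hm
    rw [hm', one_zpow, mul_one]
    exact zpow_mem h1 a
  exact hg (pow_mem hgN p)

theorem exists_pow_eq_of_commute {n : ℕ} {G : Type*} [Group G] (hcomm : ∀ a b : G, Commute a b)
    {g : G} (hg : g ∈ powSubgroup G n) : ∃ x : G, x ^ n = g := by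
  induction hg using Subgroup.closure_induction with
  | mem x hx => exact hx
  | one => exact ⟨1, one_pow n⟩
  | inv a _ ha =>
    obtain ⟨x, rfl⟩ := ha
    exact ⟨x⁻¹, inv_pow x n⟩
  | mul a b _ _ ha hb =>
    obtain ⟨x, rfl⟩ := ha
    obtain ⟨y, rfl⟩ := hb
    exact ⟨x * y, (hcomm x y).mul_pow n⟩

theorem commutatorElement_mem_of_map_le_center {G : Type*} [Group G] {M K : Subgroup G}
    [M.Normal] [K.Normal] (hM : M.map (QuotientGroup.mk' K) ≤ Subgroup.center (G ⧸ K)) {x a b : G}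
    (ha : a ∈ M ⊔ Subgroup.zpowers x) (hb : b ∈ M ⊔ Subgroup.zpowers x) : ⁅a, b⁆ ∈ K := by
  obtain ⟨m, hm, z, hz, rfl⟩ := Subgroup.mem_sup_of_normal_left.mp ha
  obtain ⟨m', hm', z', hz', rfl⟩ := Subgroup.mem_sup_of_normal_left.mp hb
  obtain ⟨i, rfl⟩ := Subgroup.mem_zpowers_iff.mp hz
  obtain ⟨j, rfl⟩ := Subgroup.mem_zpowers_iff.mp hz'
  have hc (m : G) (hm : m ∈ M) (q : G ⧸ K) : Commute (QuotientGroup.mk' K m) q :=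
    (Subgroup.mem_center_iff.mp (hM ⟨m, hm, rfl⟩) q).symm
  rw [← QuotientGroup.ker_mk' K, MonoidHom.mem_ker, map_commutatorElement,
    commutatorElement_eq_one_iff_commute, map_mul, map_mul, map_zpow, map_zpow]
  exact (hc m hm _).mul_left
    ((hc m' hm' _).symm.mul_right ((Commute.refl _).zpow_zpow i j))

/-- In a finite powerful `p`-group with `p` odd, every product of `p`-th powers is a `p`-th
power. -/
theorem IsPowerful.exists_pow_eq {p : ℕ} (hp : p.Prime) (hodd : Odd p) {G : Type*} [Group G]
    [Finite G] (hpG : IsPGroup p G) (hG : IsPowerful p G) {g : G} (hg : g ∈ powSubgroup G p) :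
    ∃ x : G, x ^ p = g := by
  have : Fact p.Prime := ⟨hp⟩
  induction hn : Nat.card G using Nat.strong_induction_on generalizing G with
  | _ n ih =>
  subst hn
  have := hpG.isNilpotent
  let M := powSubgroup G p
  let K : Subgroup G := (powSubgroup M p).map M.subtype
  have hK_le (H : Subgroup G) (hMH : M ≤ H) : K ≤ (powSubgroup H p).map H.subtype := by
    have h : K = ((powSubgroup M p).map (Subgroup.inclusion hMH)).map H.subtype := by
      rw [Subgroup.map_map]; rfl
    rw [h]
    exact Subgroup.map_mono (map_powSubgroup_le _ _)
  have hK : K.Normal := inferInstance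
  have hsurj := QuotientGroup.mk'_surjective K
  have hpow := hG.of_surjective hsurj
  have hexp := pow_eq_one_of_mem_powSubgroup_of_surjective hsurj (n := p) fun m hm => by
    rw [← map_pow, ← MonoidHom.mem_ker, QuotientGroup.ker_mk']
    exact ⟨⟨m, hm⟩ ^ p, pow_mem_powSubgroup p _, rfl⟩
  have hcen := hpow.powSubgroup_le_center hodd (G ⧸ K) hexp
  obtain ⟨x', hx'⟩ := hpow.exists_pow_eq_of_le_center hodd hcen hexp
    (map_powSubgroup_le (QuotientGroup.mk' K) p ⟨g, hg, rfl⟩)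
  obtain ⟨x, rfl⟩ := hsurj x'
  have hy : (x ^ p)⁻¹ * g ∈ K := QuotientGroup.eq.mp hx'
  let H : Subgroup G := M ⊔ Subgroup.zpowers x
  have hxH : x ∈ H := Subgroup.mem_sup_right (Subgroup.mem_zpowers x)
  have hgH : g ∈ (powSubgroup H p).map H.subtype := by
    rw [← mul_inv_cancel_left (x ^ p) g]
    exact mul_mem ⟨⟨x, hxH⟩ ^ p, pow_mem_powSubgroup p _, rfl⟩ (hK_le H le_sup_left hy)
  by_cases hH : H = ⊤
  · have hx : Subgroup.zpowers x = ⊤ := by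
      refine frattini_nongenerating (top_le_iff.mp ?_)
      rw [← hH]
      exact sup_le ((hpG.powSubgroup_le_frattini hp).trans le_sup_right) le_sup_left
    have hmem (a : G) : a ∈ Subgroup.zpowers x := by rw [hx]; exact Subgroup.mem_top a
    have hcomm (a b : G) : Commute a b := by
      obtain ⟨i, rfl⟩ := Subgroup.mem_zpowers_iff.mp (hmem a)
      obtain ⟨j, rfl⟩ := Subgroup.mem_zpowers_iff.mp (hmem b)
      exact (Commute.refl x).zpow_zpow i j
    exact exists_pow_eq_of_commute hcomm hg
  · have hHpow : IsPowerful p H := by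
      rw [IsPowerful, ← Subgroup.map_le_map_iff_of_injective H.subtype_injective,
        Subgroup.map_subtype_commutator, Subgroup.commutator_le]
      exact fun a ha b hb => hK_le H le_sup_left
        (commutatorElement_mem_of_map_le_center ((map_powSubgroup_le _ p).trans hcen) ha hb)
    obtain ⟨g', hg', rfl⟩ := hgH
    have hlt : Nat.card H < Nat.card G :=
      lt_of_le_of_ne (Subgroup.card_le_card_group H) fun h => hH (Subgroup.eq_top_of_card_eq H h)
    obtain ⟨y, rfl⟩ := ih _ hlt (hpG.to_subgroup H) hHpow hg' rfl
    exact ⟨y, rfl⟩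

theorem pth_power_product (p : ℕ) (hp : p.Prime) (hodd : Odd p)
    (G : Type*) [Group G] [Finite G]
    (hG : IsPGroup p G) (hQP : IsQuasiPowerful p G) (g h : G) :
    ∃ (j : G) (z : G), z ∈ Subgroup.center G ∧ g ^ p * h ^ p = j ^ p * z := by
  have hmem : ((g ^ p * h ^ p : G) : G ⧸ Subgroup.center G) ∈
      powSubgroup (G ⧸ Subgroup.center G) p :=
    mul_mem (pow_mem_powSubgroup p (g : G ⧸ Subgroup.center G))
      (pow_mem_powSubgroup p (h : G ⧸ Subgroup.center G))
  obtain ⟨j', hj⟩ := hQP.exists_pow_eq hp hodd (hG.to_quotient _) hmem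
  obtain ⟨j, rfl⟩ := QuotientGroup.mk_surjective j'
  exact ⟨j, (j ^ p)⁻¹ * (g ^ p * h ^ p), QuotientGroup.eq.mp hj, (mul_inv_cancel_left _ _).symm⟩
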